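/- arXiv:cs/0209012 — 4 statements merged into one kernel-verified Lean document; each statement's English description precedes it below -/
import Mathlib

section
/- Let 0 < α ≤ 5π/6, let R > 0, let V be a finite set of points of the Euclidean plane, and let r : V → ℝ be a CBTC(α)-valid radius assignment. Then the graph G_α preserves the connectivity of G_R: for all u, v ∈ V, u and v are joined by a path in G_α if and only if they are joined by a path in G_R. -/
open EuclideanGeometry Real

noncomputable section

/-- The Euclidean plane. -/
abbrev EPlane := EuclideanSpace ℝ (Fin 2)

/-- Adjacency in the graph `G_R`: two distinct points of `V` at distance at most `R`. -/
def GRAdj (R : ℝ) (V : Finset EPlane) (u v : EPlane) : Prop :=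
  u ∈ V ∧ v ∈ V ∧ u ≠ v ∧ dist u v ≤ R

/-- A radius assignment `r` is CBTC(α)-valid if every `u ∈ V` has `0 < r u ≤ R` and
either `r u = R` or `u` has no α-gap: every direction `e` is within angle `α/2`
of some neighbor of `u` at distance at most `r u`. -/
def CBTCValid (α R : ℝ) (V : Finset EPlane) (r : EPlane → ℝ) : Prop :=
  ∀ u ∈ V, (0 < r u ∧ r u ≤ R) ∧
    (r u = R ∨ ∀ e : EPlane, e ≠ 0 → ∃ v ∈ V, v ≠ u ∧ dist u v ≤ r u ∧
      InnerProductGeometry.angle (v - u) e ≤ α / 2)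

/-- Adjacency in the graph `G_α` (symmetric closure of `N_α`):
two distinct points of `V` with `dist u v ≤ max (r u) (r v)`. -/
def GAlphaAdj (V : Finset EPlane) (r : EPlane → ℝ) (u v : EPlane) : Prop :=
  u ∈ V ∧ v ∈ V ∧ u ≠ v ∧ dist u v ≤ max (r u) (r v)

/-- If a finite set of angles avoids `[-π/3, π/3]` but meets every closed interval of length `5π/6`
centered at some `t` with `|t| ≤ π/12`, then it contains two angles on both sides of `0`
whose difference is at most `5π/6`. -/
theorem exists_angles_sub_le (S : Finset ℝ) (h1 : ∀ a ∈ S, π / 3 < |a|)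
    (h2 : ∀ t, |t| ≤ π / 12 → ∃ a ∈ S, |a - t| ≤ 5 * π / 12) :
    ∃ a ∈ S, ∃ b ∈ S, π / 3 < a ∧ b < -(π / 3) ∧ a - b ≤ 5 * π / 6 := by
  have hpi := Real.pi_pos
  have hsplit : ∀ a ∈ S, π / 3 < a ∨ a < -(π / 3) := by
    intro a ha
    rcases lt_abs.1 (h1 a ha) with h | h
    · exact Or.inl h
    · exact Or.inr (by linarith)
  obtain ⟨a₀, ha₀, ha₀t⟩ := h2 (π / 12) (by rw [abs_of_pos (by positivity)])
  obtain ⟨b₀, hb₀, hb₀t⟩ := h2 (-(π / 12)) (by rw [abs_neg, abs_of_pos (by positivity)])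
  rw [abs_le] at ha₀t hb₀t
  have ha₀p : π / 3 < a₀ := (hsplit a₀ ha₀).resolve_right (by linarith)
  have hb₀n : b₀ < -(π / 3) := (hsplit b₀ hb₀).resolve_left (by linarith)
  obtain ⟨a, ha, hamin⟩ := Finset.exists_min_image (S.filter (π / 3 < ·)) id
    ⟨a₀, Finset.mem_filter.2 ⟨ha₀, ha₀p⟩⟩
  obtain ⟨b, hb, hbmax⟩ := Finset.exists_max_image (S.filter (· < -(π / 3))) id
    ⟨b₀, Finset.mem_filter.2 ⟨hb₀, hb₀n⟩⟩
  simp only [Finset.mem_filter, id] at ha hb hamin hbmax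
  have haa := hamin a₀ ⟨ha₀, ha₀p⟩
  have hbb := hbmax b₀ ⟨hb₀, hb₀n⟩
  refine ⟨a, ha.1, b, hb.1, ha.2, hb.2, ?_⟩
  by_contra! hgap
  obtain ⟨c, hc, hct⟩ := h2 ((a + b) / 2) (by rw [abs_le]; constructor <;> linarith)
  rw [abs_le] at hct
  rcases hsplit c hc with h | h
  · linarith [hamin c ⟨hc, h⟩]
  · linarith [hbmax c ⟨hc, h⟩]

/-- A monic quadratic that is nonpositive at `l` and `u` is nonpositive on `[l, u]`. -/
theorem sq_add_mul_add_nonpos {l u x B C : ℝ} (hl : l ≤ x) (hu : x ≤ u)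
    (h1 : l ^ 2 + B * l + C ≤ 0) (h2 : u ^ 2 + B * u + C ≤ 0) : x ^ 2 + B * x + C ≤ 0 := by
  rcases eq_or_lt_of_le (hl.trans hu) with h | h
  · obtain rfl : x = l := le_antisymm (by linarith) hl
    exact h1
  · have key : (u - l) * (x ^ 2 + B * x + C) =
        (u - x) * (l ^ 2 + B * l + C) + (x - l) * (u ^ 2 + B * u + C)
          - (u - l) * ((x - l) * (u - x)) := by ring
    have h3 := mul_nonneg (sub_nonneg.2 hu) (neg_nonneg.2 h1)
    have h4 := mul_nonneg (sub_nonneg.2 hl) (neg_nonneg.2 h2)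
    have h5 := mul_nonneg (sub_nonneg.2 h.le) (mul_nonneg (sub_nonneg.2 hl) (sub_nonneg.2 hu))
    by_contra! hx
    linarith [mul_pos (sub_pos.2 h) hx]

theorem sq_add_mul_add_neg {l u x B C : ℝ} (hl : l ≤ x) (hu : x ≤ u)
    (h1 : l ^ 2 + B * l + C < 0) (h2 : u ^ 2 + B * u + C < 0) : x ^ 2 + B * x + C < 0 := by
  set m := max (l ^ 2 + B * l + C) (u ^ 2 + B * u + C)
  have hm : m < 0 := max_lt h1 h2
  have := sq_add_mul_add_nonpos (B := B) (C := C - m) hl hu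
    (by linarith [le_max_left (l ^ 2 + B * l + C) (u ^ 2 + B * u + C)])
    (by linarith [le_max_right (l ^ 2 + B * l + C) (u ^ 2 + B * u + C)])
  linarith

theorem one_add_two_mul_cos_neg {x : ℝ} (h1 : π ≤ x) (h2 : x < 4 * π / 3) :
    1 + 2 * cos x < 0 := by
  have hpi := Real.pi_pos
  have h : cos (π / 3) < cos (x - π) :=
    Real.cos_lt_cos_of_nonneg_of_le_pi (by linarith) (by linarith) (by linarith)
  rw [Real.cos_pi_div_three, Real.cos_sub_pi] at h
  linarith

/-- In a quadrilateral with base of length `1`, base angles `θ`, `φ` and adjacent sides `ρ`, `σ`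
satisfying these bounds, the side opposite to the base is shorter than the base. -/
theorem fourth_side_quadratic_neg {θ φ ρ σ : ℝ} (hθ : π / 3 < θ) (hφ : π / 3 < φ)
    (hsum : θ + φ ≤ 5 * π / 6) (hρ : 2 * cos θ ≤ ρ) (hρ1 : ρ ≤ 1)
    (hσ : 2 * cos φ ≤ σ) (hσ1 : σ ≤ 1) :
    ρ ^ 2 + σ ^ 2 - 2 * ρ * cos θ - 2 * σ * cos φ + 2 * ρ * σ * cos (θ + φ) < 0 := by
  have hpi := Real.pi_pos
  have hcθ : 0 < cos θ := Real.cos_pos_of_mem_Ioo ⟨by linarith, by linarith⟩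
  have hcφ : 0 < cos φ := Real.cos_pos_of_mem_Ioo ⟨by linarith, by linarith⟩
  have hcs : cos (θ + φ) < 0 :=
    Real.cos_neg_of_pi_div_two_lt_of_lt (by linarith) (by linarith)
  have e1 : 2 * cos φ * cos (θ + φ) = cos (θ + 2 * φ) + cos θ := by
    rw [show θ + 2 * φ = (θ + φ) + φ by ring, show cos θ = cos ((θ + φ) - φ) by ring_nf,
      Real.cos_add (θ + φ), Real.cos_sub (θ + φ)]
    ring
  have e2 : 2 * cos θ * cos (θ + φ) = cos (φ + 2 * θ) + cos φ := by
    rw [show φ + 2 * θ = (θ + φ) + θ by ring, show cos φ = cos ((θ + φ) - θ) by ring_nf,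
      Real.cos_add (θ + φ), Real.cos_sub (θ + φ)]
    ring
  have c1 := one_add_two_mul_cos_neg (x := θ + 2 * φ) (by linarith) (by linarith)
  have c2 := one_add_two_mul_cos_neg (x := φ + 2 * θ) (by linarith) (by linarith)
  have c3 : 1 + cos (θ + φ) < cos θ + cos φ := by
    have hA : cos (θ + φ) = 2 * cos ((θ + φ) / 2) ^ 2 - 1 := by
      rw [← Real.cos_two_mul]; ring_nf
    have hB : cos θ + cos φ = 2 * cos ((θ + φ) / 2) * cos ((θ - φ) / 2) :=
      Real.cos_add_cos θ φ
    have hC : 0 < cos ((θ + φ) / 2) :=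
      Real.cos_pos_of_mem_Ioo ⟨by linarith, by linarith⟩
    have hD : cos ((θ + φ) / 2) < cos ((θ - φ) / 2) := by
      rw [← Real.cos_abs ((θ - φ) / 2)]
      refine Real.cos_lt_cos_of_nonneg_of_le_pi (abs_nonneg _) (by linarith) ?_
      rw [abs_lt]
      constructor <;> linarith
    nlinarith
  have c4 : cos θ * cos φ * cos (θ + φ) < 0 := mul_neg_of_pos_of_neg (mul_pos hcθ hcφ) hcs
  have edge : ∀ τ, (τ = 2 * cos φ ∨ τ = 1) →
      ρ ^ 2 + (2 * τ * cos (θ + φ) - 2 * cos θ) * ρ + (τ ^ 2 - 2 * τ * cos φ) < 0 := by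
    rintro τ (rfl | rfl) <;> refine sq_add_mul_add_neg hρ hρ1 ?_ ?_ <;> nlinarith
  have := sq_add_mul_add_neg (B := 2 * ρ * cos (θ + φ) - 2 * cos φ) (C := ρ ^ 2 - 2 * ρ * cos θ)
    hσ hσ1 (by linarith [edge _ (Or.inl rfl)]) (by linarith [edge _ (Or.inr rfl)])
  linarith

theorem norm_sq_frame {e n : EPlane} (he : ‖e‖ = 1) (hn : ‖n‖ = 1) (hen : inner ℝ e n = 0)
    (a b : ℝ) : ‖a • e + b • n‖ ^ 2 = a ^ 2 + b ^ 2 := by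
  rw [norm_add_sq_real, norm_smul, norm_smul, inner_smul_left, inner_smul_right, hen, he, hn]
  simp

/-- Polar coordinates of a plane vector in an orthonormal frame. -/
theorem exists_polar {e n : EPlane} (he : ‖e‖ = 1) (hn : ‖n‖ = 1) (hen : inner ℝ e n = 0)
    (x : EPlane) : ∃ θ : ℝ, |θ| ≤ π ∧ x = ‖x‖ • (cos θ • e + sin θ • n) := by
  have hon : Orthonormal ℝ ![e, n] := by
    rw [orthonormal_iff_ite]
    intro i j
    fin_cases i <;> fin_cases j <;>
      simp [he, hn, hen, real_inner_comm e n]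
  let b : OrthonormalBasis (Fin 2) ℝ EPlane :=
    OrthonormalBasis.mk hon (by
      rw [hon.linearIndependent.span_eq_top_of_card_eq_finrank' (by simp)])
  have hx : x = inner ℝ e x • e + inner ℝ n x • n := by
    have := b.sum_repr' x
    simpa [b, Fin.sum_univ_two] using this.symm
  set z : ℂ := ⟨inner ℝ e x, inner ℝ n x⟩ with hz
  have hnorm : ‖x‖ = ‖z‖ := by
    rw [← sq_eq_sq₀ (norm_nonneg _) (norm_nonneg _), Complex.sq_norm, Complex.normSq_apply]
    conv_lhs => rw [hx, norm_sq_frame he hn hen]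
    simp only [hz]
    ring
  refine ⟨z.arg, Complex.abs_arg_le_pi z, ?_⟩
  rw [hnorm, smul_add, smul_smul, smul_smul, Complex.norm_mul_cos_arg, Complex.norm_mul_sin_arg]
  exact hx

theorem inner_frame {e n : EPlane} (he : ‖e‖ = 1) (hn : ‖n‖ = 1) (hen : inner ℝ e n = 0)
    (a b c d : ℝ) : inner ℝ (a • e + b • n) (c • e + d • n) = a * c + b * d := by
  simp only [inner_add_left, inner_add_right, inner_smul_left, inner_smul_right, hen,
    real_inner_comm e n, real_inner_self_eq_norm_sq, he, hn]
  simp [mul_comm]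

theorem norm_polar {e n : EPlane} (he : ‖e‖ = 1) (hn : ‖n‖ = 1) (hen : inner ℝ e n = 0)
    (t : ℝ) : ‖cos t • e + sin t • n‖ = 1 := by
  have := norm_sq_frame he hn hen (cos t) (sin t)
  rw [Real.cos_sq_add_sin_sq] at this
  exact (pow_eq_one_iff_of_nonneg (norm_nonneg _) two_ne_zero).1 this

theorem angle_polar {e n : EPlane} (he : ‖e‖ = 1) (hn : ‖n‖ = 1) (hen : inner ℝ e n = 0)
    {ρ : ℝ} (hρ : 0 < ρ) (θ t : ℝ) :
    InnerProductGeometry.angle (ρ • (cos θ • e + sin θ • n)) (cos t • e + sin t • n) =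
      arccos (cos (θ - t)) := by
  rw [InnerProductGeometry.angle_smul_left_of_pos _ _ hρ, InnerProductGeometry.angle,
    norm_polar he hn hen, norm_polar he hn hen, inner_frame he hn hen, Real.cos_sub]
  simp

theorem abs_le_of_arccos_cos_le {x b : ℝ} (hx : |x| < 2 * π - b)
    (h : arccos (cos x) ≤ b) : |x| ≤ b := by
  have hb : 0 ≤ b := (Real.arccos_nonneg _).trans h
  rw [← Real.cos_abs] at h
  rcases le_or_gt |x| π with hx' | hx'
  · rwa [Real.arccos_cos (abs_nonneg x) hx'] at h
  · rw [← Real.cos_two_pi_sub, Real.arccos_cos (by linarith) (by linarith)] at h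
    linarith

/-- A node without `5π/6`-gap all of whose neighbors are at distance at least `d` from `u + d • e`
has two neighbors on both sides of the axis `e` spanning an angle of at most `5π/6`. -/
theorem exists_neighbors {V : Finset EPlane} {e n : EPlane} (he : ‖e‖ = 1) (hn : ‖n‖ = 1)
    (hen : inner ℝ e n = 0) {u : EPlane} {d ρ : ℝ} (hρ : ρ < d)
    (hgap : ∀ x : EPlane, x ≠ 0 → ∃ w ∈ V, w ≠ u ∧ dist u w ≤ ρ ∧
      InnerProductGeometry.angle (w - u) x ≤ 5 * π / 12)
    (hfar : ∀ w ∈ V, w ≠ u → dist u w ≤ ρ → d ≤ dist w (u + d • e)) :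
    ∃ θ₁ θ₂ a b : ℝ, π / 3 < θ₁ ∧ π / 3 < θ₂ ∧ θ₁ + θ₂ ≤ 5 * π / 6 ∧
      2 * d * cos θ₁ ≤ a ∧ a ≤ ρ ∧ 2 * d * cos θ₂ ≤ b ∧ b ≤ ρ ∧
      (u + a • (cos θ₁ • e + sin θ₁ • n) ∈ V ∧ 0 < a) ∧
      (u + b • (cos θ₂ • e + sin θ₂ • (-n)) ∈ V ∧ 0 < b) := by
  classical
  have hpi := Real.pi_pos
  choose ang hang hpol using exists_polar he hn hen
  set N := V.filter (fun w => w ≠ u ∧ dist u w ≤ ρ) with hN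
  have hmem : ∀ w, w ∈ N ↔ w ∈ V ∧ w ≠ u ∧ dist u w ≤ ρ := fun w => by simp [hN]
  have hpos : ∀ w ∈ N, 0 < ‖w - u‖ := fun w hw => by
    rw [norm_pos_iff, sub_ne_zero]
    exact ((hmem w).1 hw).2.1
  have hle : ∀ w ∈ N, ‖w - u‖ ≤ ρ := fun w hw => by
    rw [← dist_eq_norm, dist_comm]
    exact ((hmem w).1 hw).2.2
  have hcos : ∀ w ∈ N, 2 * d * cos (ang (w - u)) ≤ ‖w - u‖ := by
    intro w hw
    have h := hfar w ((hmem w).1 hw).1 ((hmem w).1 hw).2.1 ((hmem w).1 hw).2.2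
    have hw0 := hpos w hw
    have hwρ := hle w hw
    set l := ‖w - u‖ with hl
    set θ := ang (w - u) with hθ
    have hxy : w - (u + d • e) = (l * cos θ - d) • e + (l * sin θ) • n := by
      have := hpol (w - u)
      rw [← sub_sub, this]
      module
    have h2 : d ^ 2 ≤ dist w (u + d • e) ^ 2 := by
      have : 0 ≤ d := by linarith
      gcongr
    rw [dist_eq_norm, hxy, norm_sq_frame he hn hen] at h2
    have h3 : l * (2 * d * cos θ) ≤ l * l := by
      nlinarith [Real.sin_sq_add_cos_sq θ]
    exact le_of_mul_le_mul_left h3 hw0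
  obtain ⟨a, ha, b, hb, h1, h2, h3⟩ := exists_angles_sub_le (N.image fun w => ang (w - u))
    (by
      simp only [Finset.mem_image]
      rintro _ ⟨w, hw, rfl⟩
      by_contra! hle3
      have h5 : cos (π / 3) ≤ cos |ang (w - u)| :=
        Real.cos_le_cos_of_nonneg_of_le_pi (abs_nonneg _) (by linarith) hle3
      rw [Real.cos_pi_div_three, Real.cos_abs] at h5
      have := hcos w hw
      have h6 := hle w hw
      have h7 := hpos w hw
      nlinarith)
    (by
      intro t ht
      obtain ⟨w, hwV, hwu, hwρ, hwa⟩ := hgap (cos t • e + sin t • n) (by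
        rw [← norm_pos_iff, norm_polar he hn hen]
        exact one_pos)
      have hw : w ∈ N := (hmem w).2 ⟨hwV, hwu, hwρ⟩
      refine ⟨ang (w - u), Finset.mem_image_of_mem _ hw, ?_⟩
      rw [hpol (w - u), angle_polar he hn hen (hpos w hw)] at hwa
      refine abs_le_of_arccos_cos_le ?_ hwa
      have := abs_sub (ang (w - u)) t
      linarith [hang (w - u)])
  obtain ⟨w, hw, rfl⟩ := Finset.mem_image.1 ha
  obtain ⟨z, hz, rfl⟩ := Finset.mem_image.1 hb
  refine ⟨ang (w - u), -ang (z - u), ‖w - u‖, ‖z - u‖, h1, by linarith, by linarith, hcos w hw,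
    hle w hw, by simpa using hcos z hz, hle z hz, ⟨?_, hpos w hw⟩, ?_, hpos z hz⟩
  · rw [← hpol]
    simpa using ((hmem w).1 hw).1
  · rw [Real.cos_neg, Real.sin_neg, neg_smul_neg, ← hpol]
    simpa using ((hmem z).1 hz).1

theorem dist_fourth_side_lt {e n : EPlane} (he : ‖e‖ = 1) (hn : ‖n‖ = 1)
    (hen : inner ℝ e n = 0) (u : EPlane) {d θ φ a b : ℝ} (hd : 0 < d)
    (hθ : π / 3 < θ) (hφ : π / 3 < φ) (hsum : θ + φ ≤ 5 * π / 6)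
    (ha : 2 * d * cos θ ≤ a) (had : a ≤ d) (hb : 2 * d * cos φ ≤ b) (hbd : b ≤ d) :
    dist (u + a • (cos θ • e + sin θ • n)) (u + d • e + b • (cos φ • (-e) + sin φ • n)) < d := by
  have key := fourth_side_quadratic_neg hθ hφ hsum (ρ := a / d) (σ := b / d)
    (by rw [le_div_iff₀ hd]; linarith) (by rwa [div_le_one hd])
    (by rw [le_div_iff₀ hd]; linarith) (by rwa [div_le_one hd])
  have key2 : a ^ 2 + b ^ 2 - 2 * d * a * cos θ - 2 * d * b * cos φ
      + 2 * a * b * cos (θ + φ) < 0 := by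
    have := mul_neg_of_pos_of_neg (pow_pos hd 2) key
    field_simp at this
    linarith
  rw [dist_eq_norm, show u + a • (cos θ • e + sin θ • n) -
    (u + d • e + b • (cos φ • (-e) + sin φ • n)) =
      (a * cos θ - d + b * cos φ) • e + (a * sin θ - b * sin φ) • n by module]
  refine lt_of_pow_lt_pow_left₀ 2 hd.le ?_
  rw [norm_sq_frame he hn hen]
  rw [Real.cos_add] at key2
  nlinarith [Real.sin_sq_add_cos_sq θ, Real.sin_sq_add_cos_sq φ]

/-- Two nodes within range that are not adjacent in `G_α` can be replaced by strictly closer ones,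
each equal or `G_α`-adjacent to the original node. -/
theorem exists_closer_pair {α R : ℝ} (hα : α ≤ 5 * π / 6) {V : Finset EPlane} {r : EPlane → ℝ}
    (hr : CBTCValid α R V r) {u v : EPlane} (hu : u ∈ V) (hv : v ∈ V) (huv : u ≠ v)
    (hR : dist u v ≤ R) (hadj : ¬ GAlphaAdj V r u v) :
    ∃ u' ∈ V, ∃ v' ∈ V, dist u' v' < dist u v ∧
      (u' = u ∨ GAlphaAdj V r u u') ∧ (v' = v ∨ GAlphaAdj V r v v') := by
  have hd : 0 < dist u v := dist_pos.2 huv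
  set d := dist u v with hdd
  have hmax : max (r u) (r v) < d := by
    by_contra! h
    exact hadj ⟨hu, hv, huv, h⟩
  obtain ⟨hru, hrv⟩ := max_lt_iff.1 hmax
  have hgap : ∀ p ∈ V, r p < d → ∀ x : EPlane, x ≠ 0 → ∃ w ∈ V, w ≠ p ∧ dist p w ≤ r p ∧
      InnerProductGeometry.angle (w - p) x ≤ 5 * π / 12 := by
    intro p hp hpd x hx
    obtain ⟨w, hw, hwp, hwd, hwa⟩ := ((hr p hp).2.resolve_left (by linarith)) x hx
    exact ⟨w, hw, hwp, hwd, by linarith⟩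
  have hnbr : ∀ p ∈ V, ∀ w ∈ V, w ≠ p → dist p w ≤ r p → GAlphaAdj V r p w :=
    fun p hp w hw hwp h => ⟨hp, hw, hwp.symm, h.trans (le_max_left _ _)⟩
  by_contra! hcon
  have hadj' : ∀ p ∈ V, ∀ q ∈ V, (p = u ∨ GAlphaAdj V r u p) → (q = v ∨ GAlphaAdj V r v q) →
      d ≤ dist p q := by
    intro p hp q hq h1 h2
    by_contra! h
    obtain ⟨h3, h4⟩ := hcon p hp q hq h h1
    exact h2.elim h3 h4
  set e : EPlane := d⁻¹ • (v - u) with hedef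
  set n : EPlane := !₂[-(e 1), e 0] with hndef
  have he : ‖e‖ = 1 := by
    rw [hedef, norm_smul, ← dist_eq_norm, dist_comm v u, ← hdd, norm_inv, Real.norm_of_nonneg hd.le,
      inv_mul_cancel₀ hd.ne']
  have hn : ‖n‖ = 1 := by
    rw [← he, EuclideanSpace.norm_eq, EuclideanSpace.norm_eq]
    simp [hndef, Fin.sum_univ_two, add_comm]
  have hen : inner ℝ e n = 0 := by
    simp [hndef, PiLp.inner_apply, Fin.sum_univ_two]
    ring
  have hve : u + d • e = v := by
    rw [hedef, smul_inv_smul₀ hd.ne']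
    abel
  have hue : v + d • (-e) = u := by
    rw [← hve]
    module
  obtain ⟨θ₁, θ₂, a₁, a₂, hθ₁, hθ₂, hθ, ha₁, ha₁r, ha₂, ha₂r, ⟨hw₁, hp₁⟩, hw₂, hp₂⟩ :=
    exists_neighbors he hn hen hru (hgap u hu hru) (fun w hw hwu hwd => by
      rw [hve]
      exact hadj' w hw v hv (Or.inr (hnbr u hu w hw hwu hwd)) (Or.inl rfl))
  obtain ⟨φ₁, φ₂, b₁, b₂, hφ₁, hφ₂, hφ, hb₁, hb₁r, hb₂, hb₂r, ⟨hz₁, hq₁⟩, hz₂, hq₂⟩ :=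
    exists_neighbors (e := -e) (by rwa [norm_neg]) hn (by rw [inner_neg_left, hen, neg_zero]) hrv
      (hgap v hv hrv) (fun w hw hwv hwd => by
        rw [hue, dist_comm]
        exact hadj' u hu w hw (Or.inl rfl) (Or.inr (hnbr v hv w hw hwv hwd)))
  have hstep : ∀ p ∈ V, ∀ (f m : EPlane) (a t : ℝ), ‖f‖ = 1 → ‖m‖ = 1 → inner ℝ f m = 0 →
      0 < a → a ≤ r p → p + a • (cos t • f + sin t • m) ∈ V →
      GAlphaAdj V r p (p + a • (cos t • f + sin t • m)) := by
    intro p hp f m a t hf hm hfm ha har hV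
    have hnorm : ‖a • (cos t • f + sin t • m)‖ = a := by
      rw [norm_smul, norm_polar hf hm hfm, mul_one, Real.norm_of_nonneg ha.le]
    refine hnbr p hp _ hV ?_ ?_
    · rw [Ne, add_eq_left, ← norm_eq_zero, hnorm]
      exact ha.ne'
    · rwa [dist_self_add_right, hnorm]
  have he' : ‖-e‖ = 1 := by rwa [norm_neg]
  have hn' : ‖-n‖ = 1 := by rwa [norm_neg]
  have hen' : inner ℝ e (-n) = 0 := by rw [inner_neg_right, hen, neg_zero]
  rcases le_or_gt (θ₁ + φ₁) (5 * π / 6) with h | h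
  · have hlt := dist_fourth_side_lt he hn hen u hd hθ₁ hφ₁ h ha₁ (by linarith) hb₁ (by linarith)
    rw [hve] at hlt
    exact absurd (hadj' _ hw₁ _ hz₁
      (Or.inr (hstep u hu e n a₁ θ₁ he hn hen hp₁ ha₁r hw₁))
      (Or.inr (hstep v hv (-e) n b₁ φ₁ he' hn (by rw [inner_neg_left, hen, neg_zero])
        hq₁ hb₁r hz₁))) (not_le.2 hlt)
  · have hlt := dist_fourth_side_lt he hn' hen' u hd hθ₂ hφ₂ (by linarith) ha₂ (by linarith) hb₂
      (by linarith)
    rw [hve] at hlt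
    exact absurd (hadj' _ hw₂ _ hz₂
      (Or.inr (hstep u hu e (-n) a₂ θ₂ he hn' hen' hp₂ ha₂r hw₂))
      (Or.inr (hstep v hv (-e) (-n) b₂ φ₂ he' hn' (by rw [inner_neg_neg, hen])
        hq₂ hb₂r hz₂))) (not_le.2 hlt)

theorem GAlphaAdj.symm {V : Finset EPlane} {r : EPlane → ℝ} {u v : EPlane}
    (h : GAlphaAdj V r u v) : GAlphaAdj V r v u :=
  ⟨h.2.1, h.1, h.2.2.1.symm, by rw [dist_comm, max_comm]; exact h.2.2.2⟩

theorem reflTransGen_of_dist_le {α R : ℝ} (hα : α ≤ 5 * π / 6) {V : Finset EPlane}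
    {r : EPlane → ℝ} (hr : CBTCValid α R V r) {u v : EPlane} (hu : u ∈ V) (hv : v ∈ V)
    (hR : dist u v ≤ R) : Relation.ReflTransGen (GAlphaAdj V r) u v := by
  classical
  by_contra hcon
  obtain ⟨⟨p, q⟩, hpq, hmin⟩ := Finset.exists_min_image
    ((V ×ˢ V).filter fun x => dist x.1 x.2 ≤ R ∧ ¬ Relation.ReflTransGen (GAlphaAdj V r) x.1 x.2)
    (fun x => dist x.1 x.2) ⟨(u, v), by simp [hu, hv, hR, hcon]⟩
  simp only [Finset.mem_filter, Finset.mem_product, Prod.forall] at hpq hmin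
  obtain ⟨⟨hp, hq⟩, hd, hn⟩ := hpq
  obtain ⟨p', hp', q', hq', hlt, h1, h2⟩ := exists_closer_pair hα hr hp hq
    (by rintro rfl; exact hn .refl) hd (fun h => hn (.single h))
  have hconn : Relation.ReflTransGen (GAlphaAdj V r) p' q' := by
    by_contra h
    exact absurd (hmin p' q' ⟨⟨hp', hq'⟩, by linarith, h⟩) (not_le.2 hlt)
  have h1' : Relation.ReflTransGen (GAlphaAdj V r) p p' := by
    rcases h1 with rfl | h
    · exact .refl
    · exact .single h
  have h2' : Relation.ReflTransGen (GAlphaAdj V r) q' q := by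
    rcases h2 with rfl | h
    · exact .refl
    · exact .single h.symm
  exact hn ((h1'.trans hconn).trans h2')

/-- For `0 < α ≤ 5π/6` and a CBTC(α)-valid radius assignment, the graph `G_α`
preserves the connectivity of `G_R`. -/
theorem cbtc_connectivity (α R : ℝ) (hα : 0 < α) (hα' : α ≤ 5 * Real.pi / 6)
    (hR : 0 < R) (V : Finset EPlane) (r : EPlane → ℝ) (hr : CBTCValid α R V r)
    (u v : EPlane) (hu : u ∈ V) (hv : v ∈ V) :
    Relation.ReflTransGen (GAlphaAdj V r) u v ↔ Relation.ReflTransGen (GRAdj R V) u v := by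
  constructor
  · exact Relation.ReflTransGen.mono (fun a b h => ⟨h.1, h.2.1, h.2.2.1,
      h.2.2.2.trans (max_le (hr a h.1).1.2 (hr b h.2.1).1.2)⟩) u v
  · intro h
    induction h with
    | refl => exact .refl
    | tail _ h ih =>
      exact (ih h.1).trans (reflTransGen_of_dist_le hα' hr h.1 h.2.1 h.2.2.2)
end
end

section
/- Let 0 < α ≤ 5π/6, let R > 0, let V be a finite set of points of the Euclidean plane, let r : V → ℝ be a CBTC(α)-valid radius assignment, and let u, v ∈ V be distinct with dist u v ≤ R. Then either u and v are adjacent in G_α (i.e. dist u v ≤ max (r u) (r v)), or there exist u', v' ∈ V such that (a) dist u' v' < dist u v, (b) u' = u or u' is adjacent to u in G_α, and (c) v' = v or v' is adjacent to v in G_α. -/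
open EuclideanGeometry Real

noncomputable section

/-- A monic quadratic that is less than `1` at both ends of an interval is less than `1` on it. -/
theorem quadratic_lt_one_of_endpoints {m x b c : ℝ} (hm : m < 1) (hmx : m ≤ x) (hx : x ≤ 1)
    (h₀ : m ^ 2 + b * m + c < 1) (h₁ : 1 + b + c < 1) : x ^ 2 + b * x + c < 1 := by
  have key : (1 - m) * (x ^ 2 + b * x + c - 1) =
      (1 - x) * (m ^ 2 + b * m + c - 1) + (x - m) * (1 + b + c - 1)
        - (1 - m) * ((x - m) * (1 - x)) := by ring
  have h₂ : 0 ≤ (1 - m) * ((x - m) * (1 - x)) :=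
    mul_nonneg (by linarith) (mul_nonneg (by linarith) (by linarith))
  have h₃ : (1 - x) * (m ^ 2 + b * m + c - 1) + (x - m) * (1 + b + c - 1) < 0 := by
    rcases hx.lt_or_eq with h | h
    · nlinarith
    · subst h
      nlinarith
  by_contra! hcon
  nlinarith [mul_nonneg (sub_nonneg.2 hm.le) (sub_nonneg.2 hcon)]

theorem cos_lt_neg_half {t : ℝ} (h₁ : 2 * π / 3 < t) (h₂ : t < 4 * π / 3) :
    cos t < -(1 / 2) := by
  have h : 1 / 2 < cos (t - π) := by
    rw [← cos_abs, ← cos_pi_div_three]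
    apply cos_lt_cos_of_nonneg_of_le_pi (abs_nonneg _) (by linarith [pi_pos])
    rw [abs_lt]
    constructor <;> linarith
  rw [cos_sub_pi] at h
  linarith

/-- In polar coordinates around the ends of a unit segment, two points on the same side of the
segment, each lying inside the unit circle around its own end and outside the one around
the other end, are at distance less than `1` if their polar angles add up to at most `5π/6`. -/
theorem sq_dist_polar_lt_one {x y a b : ℝ} (ha : π / 3 < a) (hb : π / 3 < b)
    (hab : a + b ≤ 5 * π / 6) (hx : 2 * cos a ≤ x) (hx' : x ≤ 1)
    (hy : 2 * cos b ≤ y) (hy' : y ≤ 1) :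
    (x * cos a - 1 + y * cos b) ^ 2 + (x * sin a - y * sin b) ^ 2 < 1 := by
  have hπ := pi_pos
  have hpa : 0 < cos a := cos_pos_of_mem_Ioo ⟨by linarith, by linarith⟩
  have hpb : 0 < cos b := cos_pos_of_mem_Ioo ⟨by linarith, by linarith⟩
  have hpa' : cos a < 1 / 2 := by
    rw [← cos_pi_div_three]
    exact cos_lt_cos_of_nonneg_of_le_pi (by linarith) (by linarith) ha
  have hpb' : cos b < 1 / 2 := by
    rw [← cos_pi_div_three]
    exact cos_lt_cos_of_nonneg_of_le_pi (by linarith) (by linarith) hb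
  have hC : cos (a + b) < 0 :=
    cos_neg_of_pi_div_two_lt_of_lt (by linarith) (by linarith)
  have h₁ : 1 + cos (a + b) < cos a + cos b := by
    have hs : 0 < cos ((a + b) / 2) := cos_pos_of_mem_Ioo ⟨by linarith, by linarith⟩
    have hst : cos ((a + b) / 2) < cos ((a - b) / 2) := by
      rw [← cos_abs ((a - b) / 2)]
      apply cos_lt_cos_of_nonneg_of_le_pi (abs_nonneg _) (by linarith)
      rw [abs_lt]
      constructor <;> linarith
    have e : cos (a + b) = 2 * cos ((a + b) / 2) ^ 2 - 1 := by
      rw [← cos_two_mul]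
      ring_nf
    rw [e, cos_add_cos]
    nlinarith
  have h₂ : 1 - 2 * cos b + 4 * cos a * cos (a + b) < 0 := by
    have e : 4 * cos a * cos (a + b) = 2 * cos (2 * a + b) + 2 * cos b := by
      rw [show 2 * a + b = (a + b) + a by ring, cos_add (a + b) a]
      have hb' := cos_sub (a + b) a
      rw [add_sub_cancel_left] at hb'
      linear_combination -2 * hb'
    linarith [cos_lt_neg_half (t := 2 * a + b) (by linarith) (by linarith)]
  have h₃ : 1 - 2 * cos a + 4 * cos b * cos (a + b) < 0 := by
    have e : 4 * cos b * cos (a + b) = 2 * cos (2 * b + a) + 2 * cos a := by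
      rw [show 2 * b + a = (a + b) + b by ring, cos_add (a + b) b]
      have ha' := cos_sub (a + b) b
      rw [add_sub_cancel_right] at ha'
      linear_combination -2 * ha'
    linarith [cos_lt_neg_half (t := 2 * b + a) (by linarith) (by linarith)]
  have h₄ : cos a * cos b * cos (a + b) < 0 := mul_neg_of_pos_of_neg (mul_pos hpa hpb) hC
  have hx₀ : (2 * cos a) ^ 2 + (-2 * cos a + 2 * y * cos (a + b)) * (2 * cos a)
      + (y ^ 2 - 2 * y * cos b + 1) < 1 := by
    have := quadratic_lt_one_of_endpoints (m := 2 * cos b) (x := y)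
      (b := -2 * cos b + 4 * cos a * cos (a + b)) (c := 1) (by linarith) hy hy'
      (by nlinarith) (by linarith)
    linarith
  have hx₁ : 1 + (-2 * cos a + 2 * y * cos (a + b)) + (y ^ 2 - 2 * y * cos b + 1) < 1 := by
    have := quadratic_lt_one_of_endpoints (m := 2 * cos b) (x := y)
      (b := -2 * cos b + 2 * cos (a + b)) (c := 2 - 2 * cos a) (by linarith) hy hy'
      (by nlinarith) (by linarith)
    linarith
  have := quadratic_lt_one_of_endpoints (by linarith) hx hx' hx₀ hx₁
  have e : (x * cos a - 1 + y * cos b) ^ 2 + (x * sin a - y * sin b) ^ 2 =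
      x ^ 2 + (-2 * cos a + 2 * y * cos (a + b)) * x + (y ^ 2 - 2 * y * cos b + 1) := by
    rw [cos_add]
    linear_combination x ^ 2 * sin_sq_add_cos_sq a + y ^ 2 * sin_sq_add_cos_sq b
  linarith

/-- A set of points of the punctured open unit disc, all at distance at least `1` from `1`,
meeting every closed cone of angle `5π/6` with apex `0`. -/
structure IsBlockedCover (A : Finset ℂ) : Prop where
  norm_lt_one : ∀ z ∈ A, ‖z‖ < 1
  one_le_norm_sub_one : ∀ z ∈ A, 1 ≤ ‖z - 1‖
  exists_abs_arg_div_le : ∀ c : ℂ, c ≠ 0 → ∃ z ∈ A, z ≠ 0 ∧ |(z / c).arg| ≤ 5 * π / 12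

theorem two_mul_cos_arg_le_norm {z : ℂ} (hz : z ≠ 0) (h : 1 ≤ ‖z - 1‖) :
    2 * cos z.arg ≤ ‖z‖ := by
  have h₁ : 1 ≤ ‖z - 1‖ ^ 2 := by nlinarith
  have h₂ : ‖z - 1‖ ^ 2 = ‖z‖ ^ 2 - 2 * (‖z‖ * cos z.arg) + 1 := by
    rw [Complex.norm_mul_cos_arg, Complex.sq_norm, Complex.sq_norm, Complex.normSq_apply,
      Complex.normSq_apply]
    simp
    ring
  have h₃ : 0 < ‖z‖ := norm_pos_iff.2 hz
  nlinarith

theorem pi_div_three_lt_abs_arg {z : ℂ} (hz : z ≠ 0) (h : ‖z‖ < 1) (h' : 1 ≤ ‖z - 1‖) :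
    π / 3 < |z.arg| := by
  by_contra! hcon
  have := cos_le_cos_of_nonneg_of_le_pi (abs_nonneg _) (by linarith [pi_pos]) hcon
  rw [cos_abs, cos_pi_div_three] at this
  linarith [two_mul_cos_arg_le_norm hz h']

theorem norm_sub_one_add_conj_lt_one {z w : ℂ} (hz : z ≠ 0) (hw : w ≠ 0)
    (hz₁ : ‖z‖ < 1) (hw₁ : ‖w‖ < 1) (hz₂ : 1 ≤ ‖z - 1‖) (hw₂ : 1 ≤ ‖w - 1‖)
    (h : (0 < z.arg ∧ 0 < w.arg ∧ z.arg + w.arg ≤ 5 * π / 6) ∨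
      (z.arg < 0 ∧ w.arg < 0 ∧ -z.arg + -w.arg ≤ 5 * π / 6)) :
    ‖z - 1 + (starRingEnd ℂ) w‖ < 1 := by
  have hza := pi_div_three_lt_abs_arg hz hz₁ hz₂
  have hwa := pi_div_three_lt_abs_arg hw hw₁ hw₂
  have hzc := two_mul_cos_arg_le_norm hz hz₂
  have hwc := two_mul_cos_arg_le_norm hw hw₂
  have e : ‖z - 1 + (starRingEnd ℂ) w‖ ^ 2 =
      (‖z‖ * cos z.arg - 1 + ‖w‖ * cos w.arg) ^ 2
        + (‖z‖ * sin z.arg - ‖w‖ * sin w.arg) ^ 2 := by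
    simp only [Complex.norm_mul_cos_arg, Complex.norm_mul_sin_arg]
    rw [Complex.sq_norm, Complex.normSq_apply]
    simp
    ring
  have : ‖z - 1 + (starRingEnd ℂ) w‖ ^ 2 < 1 := by
    rw [e]
    rcases h with ⟨h₁, h₂, h₃⟩ | ⟨h₁, h₂, h₃⟩
    · rw [abs_of_pos h₁] at hza
      rw [abs_of_pos h₂] at hwa
      exact sq_dist_polar_lt_one hza hwa h₃ hzc hz₁.le hwc hw₁.le
    · rw [abs_of_neg h₁] at hza
      rw [abs_of_neg h₂] at hwa
      have := sq_dist_polar_lt_one (x := ‖z‖) (y := ‖w‖) hza hwa h₃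
        (by rwa [cos_neg]) hz₁.le (by rwa [cos_neg]) hw₁.le
      simp only [cos_neg, sin_neg] at this
      linarith
  nlinarith [norm_nonneg (z - 1 + (starRingEnd ℂ) w)]

namespace IsBlockedCover

variable {A B : Finset ℂ}

theorem exists_arg_mem (hA : IsBlockedCover A) {t : ℝ} (h₁ : -(π / 2) ≤ t) (h₂ : t ≤ π / 2) :
    ∃ z ∈ A, z ≠ 0 ∧ |z.arg - t| ≤ 5 * π / 12 := by
  obtain ⟨z, hzA, hz, h⟩ := hA.exists_abs_arg_div_le (Complex.exp (t * Complex.I))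
    (Complex.exp_ne_zero _)
  refine ⟨z, hzA, hz, ?_⟩
  have hπ := pi_pos
  rw [abs_le] at h
  have ht : (Complex.exp (t * Complex.I)).arg = t := by
    rw [Complex.arg_exp_mul_I, toIocMod_eq_self]
    constructor <;> linarith
  have := Complex.arg_mul (x := z / Complex.exp (t * Complex.I)) (y := Complex.exp (t * Complex.I))
    (div_ne_zero hz (Complex.exp_ne_zero _)) (Complex.exp_ne_zero _)
    (by rw [ht]; constructor <;> linarith)
  rw [div_mul_cancel₀ _ (Complex.exp_ne_zero _), ht] at this
  rw [abs_le]
  constructor <;> linarith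

/-- The smallest positive argument `a` in a blocked cover is at most `π/2`, and below every
`t < a` close to `a` the cover has a point with argument in `[t - 5π/6, 0)`. -/
theorem exists_minimal_pos_arg (hA : IsBlockedCover A) :
    ∃ z ∈ A, z ≠ 0 ∧ 0 < z.arg ∧ z.arg ≤ π / 2 ∧
      ∀ t, π / 4 ≤ t → t < z.arg →
        ∃ w ∈ A, w ≠ 0 ∧ w.arg < 0 ∧ -w.arg ≤ 5 * π / 6 - t := by
  have hπ := pi_pos
  obtain ⟨z₀, hz₀A, hz₀, h₀⟩ := hA.exists_arg_mem (t := π / 12) (by linarith) (by linarith)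
  have h₁ := pi_div_three_lt_abs_arg hz₀ (hA.norm_lt_one _ hz₀A) (hA.one_le_norm_sub_one _ hz₀A)
  rw [abs_le] at h₀
  rw [lt_abs] at h₁
  have hpos : 0 < z₀.arg := by
    rcases h₁ with h₁ | h₁ <;> linarith
  obtain ⟨z, hz, hmin⟩ := (A.filter fun z => 0 < z.arg).exists_min_image Complex.arg
    ⟨z₀, Finset.mem_filter.2 ⟨hz₀A, hpos⟩⟩
  obtain ⟨hzA, hzpos⟩ := Finset.mem_filter.1 hz
  have hle := hmin z₀ (Finset.mem_filter.2 ⟨hz₀A, hpos⟩)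
  refine ⟨z, hzA, ?_, hzpos, by linarith, fun t ht₁ ht₂ => ?_⟩
  · rintro rfl
    simp at hzpos
  obtain ⟨w, hwA, hw, h⟩ := hA.exists_arg_mem (t := t - 5 * π / 12) (by linarith) (by linarith)
  rw [abs_le] at h
  have hne := pi_div_three_lt_abs_arg hw (hA.norm_lt_one _ hwA) (hA.one_le_norm_sub_one _ hwA)
  refine ⟨w, hwA, hw, ?_, by linarith⟩
  by_contra! hw₀
  rw [abs_of_nonneg hw₀] at hne
  have := hmin w (Finset.mem_filter.2 ⟨hwA, by linarith⟩)
  linarith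

theorem exists_norm_lt_one (hA : IsBlockedCover A) (hB : IsBlockedCover B) :
    ∃ z ∈ A, ∃ w ∈ B, ‖z - 1 + (starRingEnd ℂ) w‖ < 1 := by
  obtain ⟨z, hzA, hz, hz₀, hz₁, hz₂⟩ := hA.exists_minimal_pos_arg
  obtain ⟨w, hwB, hw, hw₀, hw₁, hw₂⟩ := hB.exists_minimal_pos_arg
  have hza := pi_div_three_lt_abs_arg hz (hA.norm_lt_one _ hzA) (hA.one_le_norm_sub_one _ hzA)
  have hwa := pi_div_three_lt_abs_arg hw (hB.norm_lt_one _ hwB) (hB.one_le_norm_sub_one _ hwB)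
  rw [abs_of_pos hz₀] at hza
  rw [abs_of_pos hw₀] at hwa
  rcases le_or_gt (z.arg + w.arg) (5 * π / 6) with h | h
  · exact ⟨z, hzA, w, hwB, norm_sub_one_add_conj_lt_one hz hw (hA.norm_lt_one _ hzA)
      (hB.norm_lt_one _ hwB) (hA.one_le_norm_sub_one _ hzA) (hB.one_le_norm_sub_one _ hwB)
      (Or.inl ⟨hz₀, hw₀, h⟩)⟩
  · obtain ⟨z', hzA', hz', hz₀', hz₁'⟩ := hz₂ (z.arg - (z.arg + w.arg - 5 * π / 6) / 2)
      (by linarith) (by linarith)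
    obtain ⟨w', hwB', hw', hw₀', hw₁'⟩ := hw₂ (w.arg - (z.arg + w.arg - 5 * π / 6) / 2)
      (by linarith) (by linarith)
    exact ⟨z', hzA', w', hwB', norm_sub_one_add_conj_lt_one hz' hw' (hA.norm_lt_one _ hzA')
      (hB.norm_lt_one _ hwB') (hA.one_le_norm_sub_one _ hzA') (hB.one_le_norm_sub_one _ hwB')
      (Or.inr ⟨hz₀', hw₀', by linarith⟩)⟩

theorem image_conj (hA : IsBlockedCover A) : IsBlockedCover (A.image (starRingEnd ℂ)) where
  norm_lt_one := by
    simpa using hA.norm_lt_one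
  one_le_norm_sub_one := by
    simp only [Finset.forall_mem_image]
    intro z hz
    rw [← map_one (starRingEnd ℂ), ← map_sub, Complex.norm_conj]
    exact hA.one_le_norm_sub_one z hz
  exists_abs_arg_div_le c hc := by
    obtain ⟨z, hzA, hz, h⟩ := hA.exists_abs_arg_div_le ((starRingEnd ℂ) c) (by simpa using hc)
    refine ⟨_, Finset.mem_image_of_mem _ hzA, by simpa using hz, ?_⟩
    have e : (starRingEnd ℂ) z / c = (starRingEnd ℂ) (z / (starRingEnd ℂ) c) := by simp
    rw [e, Complex.arg_conj]
    split_ifs with h'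
    · rwa [h'] at h
    · rwa [abs_neg]

end IsBlockedCover

/-- The identification of the Euclidean plane with `ℂ`. -/
def planeToComplex : EPlane ≃ₗᵢ[ℝ] ℂ := Complex.orthonormalBasisOneI.repr.symm

/-- The coordinate of `w` in the complex frame with origin `u` and unit point `v`. -/
def frameCoord (u v w : EPlane) : ℂ := planeToComplex (w - u) / planeToComplex (v - u)

theorem planeToComplex_sub_ne_zero {u v : EPlane} (huv : u ≠ v) : planeToComplex (v - u) ≠ 0 := by
  simpa [sub_eq_zero] using huv.symm

theorem norm_frameCoord_sub (u v w w' : EPlane) :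
    ‖frameCoord u v w - frameCoord u v w'‖ = dist w w' / dist u v := by
  rw [frameCoord, frameCoord, ← sub_div, ← map_sub, norm_div, LinearIsometryEquiv.norm_map,
    LinearIsometryEquiv.norm_map, dist_comm u v, dist_eq_norm, dist_eq_norm]
  congr 2
  abel

theorem frameCoord_self_left (u v : EPlane) : frameCoord u v u = 0 := by simp [frameCoord]

theorem frameCoord_self_right {u v : EPlane} (huv : u ≠ v) : frameCoord u v v = 1 :=
  div_self (planeToComplex_sub_ne_zero huv)

theorem frameCoord_swap {u v : EPlane} (huv : u ≠ v) (w : EPlane) :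
    frameCoord v u w = 1 - frameCoord u v w := by
  have h := planeToComplex_sub_ne_zero huv
  have h' := planeToComplex_sub_ne_zero huv.symm
  have e : planeToComplex (u - v) = -planeToComplex (v - u) := by rw [← map_neg, neg_sub]
  rw [frameCoord, frameCoord, e, show w - v = (w - u) - (v - u) by abel, map_sub]
  field_simp
  ring

/-- If no neighbor of `u` is closer to `v` than `u` is, then the neighbors of `u`,
in the frame of `u` and `v`, form a blocked cover. -/
theorem isBlockedCover_frameCoord {α R : ℝ} (hα : α ≤ 5 * π / 6) {V : Finset EPlane}
    {r : EPlane → ℝ} (hr : CBTCValid α R V r) {u v : EPlane} (hu : u ∈ V) (huv : u ≠ v)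
    (hd : dist u v ≤ R) (hru : r u < dist u v)
    (hfar : ∀ w ∈ V, w ≠ u → dist u w ≤ r u → dist u v ≤ dist w v) :
    IsBlockedCover ((V.filter fun w => w ≠ u ∧ dist u w ≤ r u).image (frameCoord u v)) := by
  have hpos : 0 < dist u v := dist_pos.2 huv
  refine ⟨?_, ?_, ?_⟩
  · simp only [Finset.forall_mem_image, Finset.mem_filter]
    rintro w ⟨-, -, hw⟩
    rw [← sub_zero (frameCoord u v w), ← frameCoord_self_left u v, norm_frameCoord_sub,
      div_lt_one hpos, dist_comm]
    linarith
  · simp only [Finset.forall_mem_image, Finset.mem_filter]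
    rintro w ⟨hwV, hwu, hw⟩
    rw [← frameCoord_self_right huv, norm_frameCoord_sub, one_le_div hpos]
    exact hfar w hwV hwu hw
  · intro c hc
    have hv := planeToComplex_sub_ne_zero huv
    obtain ⟨w, hwV, hwu, hw, h⟩ := ((hr u hu).2.resolve_left (by linarith))
      (planeToComplex.symm (c * planeToComplex (v - u))) (by simpa [sub_eq_zero, hc] using huv.symm)
    have hw' := planeToComplex_sub_ne_zero hwu.symm
    refine ⟨_, Finset.mem_image_of_mem _ (Finset.mem_filter.2 ⟨hwV, hwu, hw⟩),
      div_ne_zero hw' hv, ?_⟩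
    rw [← LinearIsometry.angle_map planeToComplex.toLinearIsometry] at h
    simp only [LinearIsometryEquiv.coe_toLinearIsometry, LinearIsometryEquiv.apply_symm_apply] at h
    rw [Complex.angle_eq_abs_arg hw' (mul_ne_zero hc hv)] at h
    rw [frameCoord, div_div, mul_comm _ c]
    linarith

/-- Key lemma: if `(u,v)` is an edge of `G_R`, then either `u` and `v` are adjacent
in `G_α`, or there are `u', v' ∈ V` with `dist u' v' < dist u v`, `u' = u` or `u'`
adjacent to `u` in `G_α`, and `v' = v` or `v'` adjacent to `v` in `G_α`. -/
theorem cbtc_key_lemma (α R : ℝ) (hα : 0 < α) (hα' : α ≤ 5 * Real.pi / 6)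
    (hR : 0 < R) (V : Finset EPlane) (r : EPlane → ℝ) (hr : CBTCValid α R V r)
    (u v : EPlane) (hu : u ∈ V) (hv : v ∈ V) (huv : u ≠ v) (hd : dist u v ≤ R) :
    dist u v ≤ max (r u) (r v) ∨
      ∃ u' ∈ V, ∃ v' ∈ V, dist u' v' < dist u v ∧
        (u' = u ∨ GAlphaAdj V r u u') ∧ (v' = v ∨ GAlphaAdj V r v v') := by
  by_contra! hcon
  obtain ⟨hmax, hfar⟩ := hcon
  have hru : r u < dist u v := (le_max_left _ _).trans_lt hmax
  have hrv : r v < dist v u := dist_comm u v ▸ (le_max_right _ _).trans_lt hmax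
  have adj : ∀ p ∈ V, ∀ w ∈ V, w ≠ p → dist p w ≤ r p → GAlphaAdj V r p w :=
    fun p hp w hw hwp h => ⟨hp, hw, hwp.symm, h.trans (le_max_left _ _)⟩
  have hfar' : ∀ u' ∈ V, ∀ v' ∈ V, (u' = u ∨ GAlphaAdj V r u u') →
      (v' = v ∨ GAlphaAdj V r v v') → dist u v ≤ dist u' v' := by
    intro u' hu' v' hv' h₁ h₂
    by_contra! h
    exact (hfar u' hu' v' hv' h h₁).elim fun h₃ h₄ => h₂.elim h₃ h₄
  have hA := isBlockedCover_frameCoord hα' hr hu huv hd hru fun w hw hwu h =>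
    hfar' w hw v hv (Or.inr (adj u hu w hw hwu h)) (Or.inl rfl)
  have hB := (isBlockedCover_frameCoord hα' hr hv huv.symm (dist_comm u v ▸ hd) hrv
    fun w hw hwv h => by
      rw [dist_comm v u, dist_comm w u]
      exact hfar' u hu w hw (Or.inl rfl) (Or.inr (adj v hv w hw hwv h))).image_conj
  obtain ⟨z, hz, z', hz', hlt⟩ := hA.exists_norm_lt_one hB
  simp only [Finset.mem_image, Finset.mem_filter] at hz hz'
  obtain ⟨w, ⟨hw, hwu, hwr⟩, rfl⟩ := hz
  obtain ⟨_, ⟨w', ⟨hw', hwv, hwr'⟩, rfl⟩, rfl⟩ := hz'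
  rw [Complex.conj_conj, frameCoord_swap huv, sub_add_sub_cancel, norm_frameCoord_sub,
    div_lt_one (dist_pos.2 huv)] at hlt
  exact hlt.not_ge (hfar' w hw w' hw' (Or.inr (adj u hu w hw hwu hwr))
    (Or.inr (adj v hv w' hw' hwv hwr')))
end
end

section
/- For every real α with 5π/6 < α and every real R > 0, there exist a finite set V of points of the Euclidean plane and a CBTC(α)-valid radius assignment r : V → ℝ such that the graph G_R on V is connected but the graph G_α on V is not connected. In other words, the bound 5π/6 in the connectivity theorem for the cone-based topology control algorithm is tight. -/
open EuclideanGeometry Real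

noncomputable section

/-- A cluster `A` around the origin without `α`-gap, together with its reflection `q - A`,
is a counterexample as soon as `0` and `q` are the only points of the two clusters within
distance `R` of each other. -/
theorem exists_disconnected_of_cluster {α R s : ℝ} {q : EPlane} {A : Finset EPlane}
    (h0 : 0 ∈ A) (hs : 0 < s) (hsR : s < R) (hq : ‖q‖ = R) (hA : ∀ a ∈ A, ‖a‖ ≤ s)
    (hsep : ∀ a ∈ A, ∀ b ∈ A, (a = 0 ∧ b = 0) ∨ R < ‖a + b - q‖)
    (hcov : ∀ e : EPlane, e ≠ 0 → ∃ a ∈ A, a ≠ 0 ∧ InnerProductGeometry.angle a e ≤ α / 2) :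
    ∃ (V : Finset EPlane) (r : EPlane → ℝ), CBTCValid α R V r ∧
      (∀ u ∈ V, ∀ v ∈ V, Relation.ReflTransGen (GRAdj R V) u v) ∧
      ∃ u ∈ V, ∃ v ∈ V, ¬ Relation.ReflTransGen (GAlphaAdj V r) u v := by
  classical
  have hR : 0 < R := hs.trans hsR
  have hqA : q ∉ A := fun h => by linarith [hA q h]
  let V : Finset EPlane := A ∪ A.image (fun a => q - a)
  let r : EPlane → ℝ := fun u => if u = 0 ∨ u = q then s else R
  have memV : ∀ u, u ∈ V ↔ u ∈ A ∨ ∃ a ∈ A, q - a = u := by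
    intro u
    simp [V]
  have hV0 : (0 : EPlane) ∈ V := (memV 0).2 (Or.inl h0)
  have hVq : q ∈ V := (memV q).2 (Or.inr ⟨0, h0, sub_zero q⟩)
  have hr0 : r 0 = s := if_pos (Or.inl rfl)
  have hrq : r q = s := if_pos (Or.inr rfl)
  have hrR : ∀ u, r u ≤ R := by
    intro u
    simp only [r]
    split_ifs <;> linarith
  refine ⟨V, r, ?_, ?_, 0, hV0, q, hVq, ?_⟩
  · intro u _
    by_cases hu0 : u = 0
    · subst hu0
      refine ⟨by rw [hr0]; exact ⟨hs, hsR.le⟩, Or.inr fun e he => ?_⟩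
      obtain ⟨a, ha, ha0, hae⟩ := hcov e he
      refine ⟨a, (memV a).2 (Or.inl ha), ha0, ?_, by simpa using hae⟩
      rw [hr0, dist_zero_left]
      exact hA a ha
    by_cases huq : u = q
    · subst huq
      refine ⟨by rw [hrq]; exact ⟨hs, hsR.le⟩, Or.inr fun e he => ?_⟩
      obtain ⟨a, ha, ha0, hae⟩ := hcov (-e) (neg_ne_zero.2 he)
      refine ⟨u - a, (memV _).2 (Or.inr ⟨a, ha, rfl⟩), by simpa using ha0, ?_, ?_⟩
      · rw [hrq, dist_eq_norm, sub_sub_cancel]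
        exact hA a ha
      · rw [sub_sub_cancel_left, ← InnerProductGeometry.angle_neg_neg, neg_neg]
        exact hae
    · have hru : r u = R := if_neg (by tauto)
      exact ⟨by rw [hru]; exact ⟨hR, le_rfl⟩, Or.inl hru⟩
  · have hsymm : Std.Symm (GRAdj R V) := ⟨fun u v h =>
      ⟨h.2.1, h.1, h.2.2.1.symm, by rw [dist_comm]; exact h.2.2.2⟩⟩
    have hadj : ∀ u ∈ V, ∀ v ∈ V, dist u v ≤ R → Relation.ReflTransGen (GRAdj R V) u v := by
      intro u hu v hv h
      by_cases huv : u = v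
      · rw [huv]
      · exact .single ⟨hu, hv, huv, h⟩
    have hto : ∀ u ∈ V, Relation.ReflTransGen (GRAdj R V) u 0 := by
      intro u hu
      rcases (memV u).1 hu with ha | ⟨a, ha, rfl⟩
      · exact hadj u hu 0 hV0 (by rw [dist_zero_right]; linarith [hA u ha])
      · refine (hadj _ hu q hVq ?_).trans (hadj q hVq 0 hV0 (by rw [dist_zero_right, hq]))
        rw [dist_comm, dist_eq_norm, sub_sub_cancel]
        linarith [hA a ha]
    intro u hu v hv
    exact (hto u hu).trans (Relation.ReflTransGen.stdSymm.symm _ _ (hto v hv))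
  · suffices hmem : ∀ w, Relation.ReflTransGen (GAlphaAdj V r) 0 w → w ∈ A from
      fun h => hqA (hmem q h)
    intro w h
    induction h with
    | refl => exact h0
    | @tail u v _ huv hu =>
      obtain ⟨-, hv, -, hd⟩ := huv
      rcases (memV v).1 hv with hvA | ⟨b, hb, rfl⟩
      · exact hvA
      · exfalso
        rcases hsep u hu b hb with ⟨rfl, rfl⟩ | hlt
        · rw [sub_zero, dist_zero_left, hq, hr0, hrq, max_self] at hd
          linarith
        · have : dist u (q - b) = ‖u + b - q‖ := by
            rw [dist_eq_norm]
            congr 1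
            abel
          linarith [max_le (hrR u) (hrR (q - b))]

/-- The point with polar coordinates `(t, a)`. -/
def polarPoint (t a : ℝ) : EPlane := !₂[t * cos a, t * sin a]

theorem norm_polarPoint {t : ℝ} (ht : 0 ≤ t) (a : ℝ) : ‖polarPoint t a‖ = t := by
  rw [EuclideanSpace.norm_eq, Real.sqrt_eq_iff_mul_self_eq (by positivity) ht]
  simp [polarPoint, Fin.sum_univ_two]
  nlinarith [sin_sq_add_cos_sq a]

theorem polarPoint_ne_zero {t : ℝ} (ht : 0 < t) (a : ℝ) : polarPoint t a ≠ 0 := by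
  rw [← norm_ne_zero_iff, norm_polarPoint ht.le]
  exact ht.ne'

theorem exists_eq_polarPoint {e : EPlane} (he : e ≠ 0) :
    ∃ t φ : ℝ, 0 < t ∧ -π < φ ∧ φ ≤ π ∧ e = polarPoint t φ := by
  let z : ℂ := ⟨e 0, e 1⟩
  have hz : z ≠ 0 := by
    intro h
    apply he
    ext i
    fin_cases i
    · exact congrArg Complex.re h
    · exact congrArg Complex.im h
  refine ⟨‖z‖, z.arg, norm_pos_iff.2 hz, Complex.neg_pi_lt_arg z, Complex.arg_le_pi z, ?_⟩
  ext i
  fin_cases i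
  · simp [polarPoint, Complex.norm_mul_cos_arg, z]
  · simp [polarPoint, Complex.norm_mul_sin_arg, z]

theorem angle_polarPoint_le {t u a b β : ℝ} (ht : 0 < t) (hu : 0 < u) (hβ : |a - b| ≤ β)
    (hπ : β ≤ π) : InnerProductGeometry.angle (polarPoint t a) (polarPoint u b) ≤ β := by
  have h : inner ℝ (polarPoint t a) (polarPoint u b) / (t * u) = cos |a - b| := by
    rw [div_eq_iff (by positivity), cos_abs, cos_sub]
    simp [polarPoint, PiLp.inner_apply, Fin.sum_univ_two]
    ring
  rw [InnerProductGeometry.angle, norm_polarPoint ht.le, norm_polarPoint hu.le, h,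
    arccos_cos (abs_nonneg _) (hβ.trans hπ)]
  exact hβ

theorem lt_norm_of_sq_lt {R : ℝ} {x : EPlane} (h : R ^ 2 < x 0 ^ 2 + x 1 ^ 2) : R < ‖x‖ := by
  refine lt_of_pow_lt_pow_left₀ 2 (norm_nonneg x) ?_
  rw [EuclideanSpace.norm_sq_eq, Fin.sum_univ_two]
  simpa using h

/-- Points in the directions `π / 3 + ε`, `-π / 2` and `π` leave no gap of more than
`5 * π / 6 + ε`. -/
theorem exists_angle_le_of_three_directions {ε t₁ t₂ t₃ : ℝ} (hε : 0 ≤ ε) (hε' : ε ≤ π / 12)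
    (h₁ : 0 < t₁) (h₂ : 0 < t₂) (h₃ : 0 < t₃) {e : EPlane} (he : e ≠ 0) :
    ∃ a ∈ ({polarPoint t₁ (π / 3 + ε), polarPoint t₂ (-(π / 2)), polarPoint t₃ π} : Set EPlane),
      InnerProductGeometry.angle a e ≤ (5 * π / 6 + ε) / 2 := by
  obtain ⟨t, φ, ht, hφ, hφ', rfl⟩ := exists_eq_polarPoint he
  have hπ := pi_pos
  have hβ : (5 * π / 6 + ε) / 2 ≤ π := by linarith
  rcases le_total φ (-(11 * π / 12)) with h | h
  · refine ⟨_, Or.inr (Or.inr rfl), ?_⟩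
    have hflip : polarPoint t₃ π = polarPoint t₃ (-π) := by simp [polarPoint]
    rw [hflip]
    exact angle_polarPoint_le h₃ ht (abs_le.2 ⟨by linarith, by linarith⟩) hβ
  rcases le_total φ (-(π / 12) + ε / 2) with h' | h'
  · exact ⟨_, Or.inr (Or.inl rfl),
      angle_polarPoint_le h₂ ht (abs_le.2 ⟨by linarith, by linarith⟩) hβ⟩
  rcases le_total φ (3 * π / 4) with h'' | h''
  · exact ⟨_, Or.inl rfl,
      angle_polarPoint_le h₁ ht (abs_le.2 ⟨by linarith, by linarith⟩) hβ⟩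
  · exact ⟨_, Or.inr (Or.inr rfl),
      angle_polarPoint_le h₃ ht (abs_le.2 ⟨by linarith, by linarith⟩) hβ⟩

/-- A point of the cluster `{0, R • (x, y), R • (0, -δ), R • (-1 / 2, 0)}` and one of its
reflection in `(R / 2, 0)` are at distance greater than `R`, unless they are `0` and `(R, 0)`. -/
theorem lt_norm_add_sub_of_cluster {R x y δ : ℝ} (hR : 0 < R) (hδ : 0 < δ)
    (k01 : 1 < (x - 1) ^ 2 + y ^ 2) (k11 : 1 < (2 * x - 1) ^ 2 + (2 * y) ^ 2)
    (k12 : 1 < (x - 1) ^ 2 + (y - δ) ^ 2) (k13 : 1 < (x - 3 / 2) ^ 2 + y ^ 2)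
    {a b : EPlane} (ha : a = 0 ∨ a = !₂[x * R, y * R] ∨ a = !₂[0, -(δ * R)] ∨
      a = !₂[-(1 / 2 * R), 0])
    (hb : b = 0 ∨ b = !₂[x * R, y * R] ∨ b = !₂[0, -(δ * R)] ∨ b = !₂[-(1 / 2 * R), 0]) :
    (a = 0 ∧ b = 0) ∨ R < ‖a + b - !₂[R, 0]‖ := by
  have hsep : ∀ x y : ℝ, ∀ p : EPlane, p 0 = x * R → p 1 = y * R → 1 < x ^ 2 + y ^ 2 →
      R < ‖p‖ := by
    intro x y p hx hy h
    refine lt_norm_of_sq_lt ?_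
    rw [hx, hy, mul_pow, mul_pow, ← add_mul]
    exact lt_mul_of_one_lt_left (by positivity) h
  have hδ2 : 0 < δ ^ 2 := by positivity
  rcases ha with rfl | rfl | rfl | rfl <;> rcases hb with rfl | rfl | rfl | rfl
  · exact Or.inl ⟨rfl, rfl⟩
  all_goals right
  · exact hsep (x - 1) y _ (by simp; ring) (by simp) k01
  · exact hsep (-1) (-δ) _ (by simp) (by simp) (by linarith)
  · exact hsep (-3 / 2) 0 _ (by simp; ring) (by simp) (by norm_num)
  · exact hsep (x - 1) y _ (by simp; ring) (by simp) k01
  · exact hsep (2 * x - 1) (2 * y) _ (by simp; ring) (by simp; ring) k11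
  · exact hsep (x - 1) (y - δ) _ (by simp; ring) (by simp; ring) k12
  · exact hsep (x - 3 / 2) y _ (by simp; ring) (by simp) k13
  · exact hsep (-1) (-δ) _ (by simp) (by simp) (by linarith)
  · exact hsep (x - 1) (y - δ) _ (by simp; ring) (by simp; ring) k12
  · exact hsep (-1) (-2 * δ) _ (by simp) (by simp; ring) (by linarith)
  · exact hsep (-3 / 2) (-δ) _ (by simp; ring) (by simp) (by linarith)
  · exact hsep (-3 / 2) 0 _ (by simp; ring) (by simp) (by norm_num)
  · exact hsep (x - 3 / 2) y _ (by simp; ring) (by simp) k13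
  · exact hsep (-3 / 2) (-δ) _ (by simp; ring) (by simp) (by linarith)
  · exact hsep (-2) 0 _ (by simp; ring) (by simp) (by norm_num)

/-- For every `α > 5π/6` and `R > 0` there is a network `G_R` that is connected
together with a CBTC(α)-valid radius assignment for which `G_α` is not connected:
the bound `5π/6` is tight. -/
theorem cbtc_bound_tight (α R : ℝ) (hα : 5 * Real.pi / 6 < α) (hR : 0 < R) :
    ∃ (V : Finset EPlane) (r : EPlane → ℝ), CBTCValid α R V r ∧
      (∀ u ∈ V, ∀ v ∈ V, Relation.ReflTransGen (GRAdj R V) u v) ∧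
      ∃ u ∈ V, ∃ v ∈ V, ¬ Relation.ReflTransGen (GAlphaAdj V r) u v := by
  classical
  have hπ := pi_pos
  obtain ⟨ε, hε, hε', hεα⟩ : ∃ ε : ℝ, 0 < ε ∧ ε ≤ π / 12 ∧ 5 * π / 6 + ε ≤ α :=
    ⟨min (π / 12) (α - 5 * π / 6), lt_min (by linarith) (by linarith), min_le_left _ _,
      by linarith [min_le_right (π / 12) (α - 5 * π / 6)]⟩
  set c := cos (π / 3 + ε)
  set d := sin (π / 3 + ε)
  have hc0 : 0 < c := cos_pos_of_mem_Ioo ⟨by linarith, by linarith⟩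
  have hc1 : c < 1 / 2 := by
    rw [← cos_pi_div_three]
    exact cos_lt_cos_of_nonneg_of_le_pi (by linarith) (by linarith) (by linarith)
  have hcd : d ^ 2 + c ^ 2 = 1 := sin_sq_add_cos_sq _
  have hd1 : d ≤ 1 := sin_le_one _
  set s := 1 / 2 + c with hs
  set δ := 1 / 4 - c / 2 with hδ
  have hδ0 : 0 < δ := by linarith
  have hs0 : 0 < s := by linarith
  have h₁ : 0 < s * R := by positivity
  have h₂ : 0 < δ * R := by positivity
  have h₃ : 0 < 1 / 2 * R := by positivity
  have k01 : 1 < (s * c - 1) ^ 2 + (s * d) ^ 2 := by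
    have : (s * c - 1) ^ 2 + (s * d) ^ 2 = s ^ 2 * (d ^ 2 + c ^ 2) - 2 * s * c + 1 := by ring
    rw [this, hcd]
    nlinarith
  have k11 : 1 < (2 * (s * c) - 1) ^ 2 + (2 * (s * d)) ^ 2 := by
    have : (2 * (s * c) - 1) ^ 2 + (2 * (s * d)) ^ 2
      = 4 * s ^ 2 * (d ^ 2 + c ^ 2) - 4 * s * c + 1 := by ring
    rw [this, hcd]
    nlinarith
  have k12 : 1 < (s * c - 1) ^ 2 + (s * d - δ) ^ 2 := by
    have : (s * c - 1) ^ 2 + (s * d - δ) ^ 2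
      = s ^ 2 * (d ^ 2 + c ^ 2) - 2 * s * c + 1 - 2 * s * δ * d + δ ^ 2 := by ring
    rw [this, hcd]
    have h2 : s ^ 2 - 2 * s * c = 2 * s * δ := by rw [hs, hδ]; ring
    nlinarith [mul_nonneg (mul_pos hs0 hδ0).le (sub_nonneg.2 hd1), pow_pos hδ0 2]
  have k13 : 1 < (s * c - 3 / 2) ^ 2 + (s * d) ^ 2 := by
    have : s * c < 1 / 2 := by nlinarith
    nlinarith [sq_nonneg (s * d)]
  have hp₁ (t : ℝ) : polarPoint t (π / 3 + ε) = !₂[t * c, t * d] := rfl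
  have hp₂ (t : ℝ) : polarPoint t (-(π / 2)) = !₂[0, -t] := by simp [polarPoint]
  have hp₃ (t : ℝ) : polarPoint t π = !₂[-t, 0] := by simp [polarPoint]
  have hp₀ : polarPoint R 0 = !₂[R, 0] := by simp [polarPoint]
  refine exists_disconnected_of_cluster (s := s * R) (q := polarPoint R 0)
    (A := {0, polarPoint (s * R) (π / 3 + ε), polarPoint (δ * R) (-(π / 2)),
      polarPoint (1 / 2 * R) π}) (by simp) h₁
    (mul_lt_of_lt_one_left hR (by linarith)) (norm_polarPoint hR.le 0) ?_ ?_ ?_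
  · intro a ha
    simp only [Finset.mem_insert, Finset.mem_singleton] at ha
    rcases ha with rfl | rfl | rfl | rfl
    · simpa using h₁.le
    · exact (norm_polarPoint h₁.le _).le
    · rw [norm_polarPoint h₂.le]
      exact mul_le_mul_of_nonneg_right (by linarith) hR.le
    · rw [norm_polarPoint h₃.le]
      exact mul_le_mul_of_nonneg_right (by linarith) hR.le
  · intro a ha b hb
    simp only [Finset.mem_insert, Finset.mem_singleton, hp₁, hp₂, hp₃] at ha hb
    rw [hp₀]
    exact lt_norm_add_sub_of_cluster hR hδ0 k01 k11 k12 k13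
      (by simpa only [mul_right_comm s R] using ha) (by simpa only [mul_right_comm s R] using hb)
  · intro e he
    obtain ⟨a, ha, hae⟩ := exists_angle_le_of_three_directions hε.le hε' h₁ h₂ h₃ he
    refine ⟨a, ?_, ?_, by linarith⟩
    · simp only [Finset.mem_insert, Finset.mem_singleton]
      exact Or.inr ha
    · rcases ha with rfl | rfl | rfl
      · exact polarPoint_ne_zero h₁ _
      · exact polarPoint_ne_zero h₂ _
      · exact polarPoint_ne_zero h₃ _
end
end

section
/- Let 0 < α ≤ 2π/3, let R > 0, let V be a finite set of points of the Euclidean plane, let r : V → ℝ be a CBTC(α)-valid radius assignment, and let u, v ∈ V be distinct with dist u v ≤ R. Then either (u,v) ∈ N_α (i.e. dist u v ≤ r u), or there exists a finite sequence of points u = u_0, u_1, …, u_k = v in V such that for every i < k: u_i ≠ u_{i+1}, (u_i, u_{i+1}) ∈ N_α (i.e. dist u_i u_{i+1} ≤ r u_i), and dist u_i u_{i+1} < dist u v. -/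
open EuclideanGeometry Real

noncomputable section

/-- If `w` is closer to `u` than `v` is, and the angle at `u` is at most `π/3`, then `w` is
strictly closer to `v` than `u` is. -/
theorem dist_lt_of_angle_le_pi_div_three {u v w : EPlane} (hwu : w ≠ u)
    (hlt : dist u w < dist u v)
    (hangle : InnerProductGeometry.angle (w - u) (v - u) ≤ Real.pi / 3) :
    dist w v < dist u v := by
  have hcos : 1 / 2 ≤ Real.cos (InnerProductGeometry.angle (w - u) (v - u)) := by
    rw [← Real.cos_pi_div_three]
    exact Real.cos_le_cos_of_nonneg_of_le_pi (InnerProductGeometry.angle_nonneg _ _)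
      (by linarith [Real.pi_pos]) hangle
  have hlaw := norm_sub_sq_real (w - u) (v - u)
  rw [← InnerProductGeometry.cos_angle_mul_norm_mul_norm (w - u) (v - u),
    sub_sub_sub_cancel_right, ← dist_eq_norm, ← dist_eq_norm, ← dist_eq_norm,
    dist_comm w u, dist_comm v u] at hlaw
  have hpos : 0 < dist u w := dist_pos.mpr hwu.symm
  have hmul := mul_le_mul_of_nonneg_right hcos
    (mul_nonneg hpos.le (dist_nonneg (x := u) (y := v)))
  refine lt_of_pow_lt_pow_left₀ 2 dist_nonneg ?_
  nlinarith [mul_lt_mul_of_pos_left hlt hpos]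

/-- A node `u` that does not reach `v` has an out-neighbor strictly closer to `v`. -/
theorem CBTCValid.exists_closer {α R : ℝ} (hα : α ≤ 2 * Real.pi / 3) {V : Finset EPlane}
    {r : EPlane → ℝ} (hr : CBTCValid α R V r) {u v : EPlane} (hu : u ∈ V)
    (hd : dist u v ≤ R) (hlt : r u < dist u v) :
    ∃ w ∈ V, w ≠ u ∧ dist u w ≤ r u ∧ dist w v < dist u v := by
  obtain ⟨⟨hpos, -⟩, hR | hgap⟩ := hr u hu
  · linarith
  · have huv : u ≠ v := dist_pos.mp (hpos.trans hlt)
    obtain ⟨w, hwV, hwu, hw, hangle⟩ := hgap (v - u) (sub_ne_zero.mpr huv.symm)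
    exact ⟨w, hwV, hwu, hw,
      dist_lt_of_angle_le_pi_div_three hwu (hw.trans_lt hlt) (by linarith)⟩

/-- There is a directed path of `N_α` from `u` to `v` all of whose edges are shorter than `D`. -/
def ShortPath (V : Finset EPlane) (r : EPlane → ℝ) (D : ℝ) (u v : EPlane) : Prop :=
  ∃ (k : ℕ) (p : ℕ → EPlane), p 0 = u ∧ p k = v ∧ (∀ i ≤ k, p i ∈ V) ∧
    ∀ i < k, p i ≠ p (i + 1) ∧ dist (p i) (p (i + 1)) ≤ r (p i) ∧
      dist (p i) (p (i + 1)) < D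

theorem ShortPath.refl {V : Finset EPlane} {r : EPlane → ℝ} {D : ℝ} {v : EPlane} (hv : v ∈ V) :
    ShortPath V r D v v :=
  ⟨0, fun _ => v, rfl, rfl, fun _ _ => hv, fun _ hi => absurd hi (Nat.not_lt_zero _)⟩

theorem ShortPath.cons {V : Finset EPlane} {r : EPlane → ℝ} {D : ℝ} {u w v : EPlane}
    (hu : u ∈ V) (huw : u ≠ w) (hr : dist u w ≤ r u) (hD : dist u w < D)
    (h : ShortPath V r D w v) : ShortPath V r D u v := by
  obtain ⟨k, p, rfl, rfl, hV, hstep⟩ := h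
  refine ⟨k + 1, fun i => Nat.casesOn i u p, rfl, rfl, ?_, ?_⟩
  · rintro (_ | i) hi
    · exact hu
    · exact hV i (by omega)
  · rintro (_ | i) hi
    · exact ⟨huw, hr, hD⟩
    · exact hstep i (by omega)

/-- Every node at distance less than `D ≤ R` from `v` has a path to `v` with edges shorter
than `D`. -/
theorem CBTCValid.shortPath {α R : ℝ} (hα : α ≤ 2 * Real.pi / 3) {V : Finset EPlane}
    {r : EPlane → ℝ} (hr : CBTCValid α R V r) {v : EPlane} (hv : v ∈ V) {D : ℝ} (hDR : D ≤ R)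
    {u : EPlane} (hu : u ∈ V) (hD : dist u v < D) : ShortPath V r D u v := by
  induction hn : (V.filter fun x => dist x v < dist u v).card using Nat.strong_induction_on
    generalizing u with
  | _ n ih =>
    subst hn
    rcases le_or_gt (dist u v) (r u) with hle | hlt
    · by_cases huv : u = v
      · subst huv
        exact ShortPath.refl hu
      · exact (ShortPath.refl hv).cons hu huv hle hD
    · obtain ⟨w, hwV, hwu, hw, hcloser⟩ := hr.exists_closer hα hu (hD.le.trans hDR) hlt
      refine (ih _ (Finset.card_lt_card ?_) hwV (hcloser.trans hD) rfl).cons hu hwu.symm hw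
        (hw.trans_lt (hlt.trans hD))
      rw [Finset.ssubset_iff_of_subset
        (Finset.monotone_filter_right V fun x _ hx => hx.trans hcloser)]
      exact ⟨w, by simp [hwV, hcloser], by simp⟩

/-- For `0 < α ≤ 2π/3`: if `(u,v)` is an edge of `G_R`, then either `(u,v) ∈ N_α`,
or there is a path from `u` to `v` all of whose consecutive pairs are directed
edges of `N_α` shorter than `dist u v`. -/
theorem cbtc_directed_short_path (α R : ℝ) (hα : 0 < α) (hα' : α ≤ 2 * Real.pi / 3)
    (hR : 0 < R) (V : Finset EPlane) (r : EPlane → ℝ) (hr : CBTCValid α R V r)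
    (u v : EPlane) (hu : u ∈ V) (hv : v ∈ V) (huv : u ≠ v) (hd : dist u v ≤ R) :
    dist u v ≤ r u ∨
      ∃ (k : ℕ) (p : ℕ → EPlane), p 0 = u ∧ p k = v ∧ (∀ i ≤ k, p i ∈ V) ∧
        ∀ i < k, p i ≠ p (i + 1) ∧ dist (p i) (p (i + 1)) ≤ r (p i) ∧
          dist (p i) (p (i + 1)) < dist u v := by
  rcases le_or_gt (dist u v) (r u) with hle | hlt
  · exact Or.inl hle
  · obtain ⟨w, hwV, hwu, hw, hcloser⟩ := hr.exists_closer hα' hu hd hlt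
    exact Or.inr ((hr.shortPath hα' hv hd hwV hcloser).cons hu hwu.symm hw (hw.trans_lt hlt))
end
end
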